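/- arXiv:1504.00627 — 2 statements merged into one kernel-verified Lean document; each statement's English description precedes it below -/
import Mathlib

section
/- Let k ≥ 1 and let r_1 < r_2 < ⋯ < r_k and ℓ_1 > ℓ_2 > ⋯ > ℓ_k be positive integers with r_k ≤ ℓ_k. Let n_1, …, n_k be positive integers such that n_k ≥ r_k and n_i > ℓ_{i+1} for every 1 ≤ i ≤ k−1. Then Σ_{i=1}^k 1/n_i ≤ 1. -/
/-- Let `k ≥ 1` and let `r_1 < r_2 < ⋯ < r_k` and `ℓ_1 > ℓ_2 > ⋯ > ℓ_k`
be positive integers with `r_k ≤ ℓ_k`. Let `n_1, …, n_k` be positive integers such that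
`n_k ≥ r_k` and `n_i > ℓ_{i+1}` for every `1 ≤ i ≤ k−1`. Then `∑_{i=1}^k 1/n_i ≤ 1`. -/
theorem nested_grid_reciprocal_sum_le_one (k : ℕ) (hk : 1 ≤ k) (r ℓ n : ℕ → ℕ)
    (hr0 : ∀ i, 1 ≤ i → i ≤ k → 0 < r i)
    (hl0 : ∀ i, 1 ≤ i → i ≤ k → 0 < ℓ i)
    (hn0 : ∀ i, 1 ≤ i → i ≤ k → 0 < n i)
    (hrmono : ∀ i, 1 ≤ i → i < k → r i < r (i + 1))
    (hlmono : ∀ i, 1 ≤ i → i < k → ℓ (i + 1) < ℓ i)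
    (hrl : r k ≤ ℓ k)
    (hnk : r k ≤ n k)
    (hni : ∀ i, 1 ≤ i → i < k → ℓ (i + 1) < n i) :
    ∑ i ∈ Finset.Icc 1 k, (1 : ℝ) / n i ≤ 1 := by
  have hr : ∀ i, 1 ≤ i → i ≤ k → i ≤ r i := by
    intro i hi
    induction i, hi using Nat.le_induction with
    | base => exact hr0 1 le_rfl
    | succ i hi ih =>
      intro hik
      have := ih (by omega)
      have := hrmono i hi (by omega)
      omega
  have hkr := hr k hk le_rfl
  have hl : ∀ i, 1 ≤ i → i ≤ k → ℓ k ≤ ℓ i := by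
    intro i hi hik
    induction hik using Nat.decreasingInduction with
    | self => exact le_rfl
    | of_succ i hik ih => exact (ih (by omega)).trans (hlmono i hi hik).le
  have hn : ∀ i, 1 ≤ i → i ≤ k → k ≤ n i := by
    intro i hi hik
    rcases hik.eq_or_lt with rfl | hik
    · exact hkr.trans hnk
    · have := hl (i + 1) (by omega) hik
      have := hni i hi hik
      omega
  have hk0 : (0 : ℝ) < k := by exact_mod_cast hk
  calc ∑ i ∈ Finset.Icc 1 k, (1 : ℝ) / n i
      ≤ ∑ _i ∈ Finset.Icc 1 k, (1 : ℝ) / k := by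
        refine Finset.sum_le_sum fun i hi => ?_
        obtain ⟨hi, hik⟩ := Finset.mem_Icc.mp hi
        exact one_div_le_one_div_of_le hk0 (by exact_mod_cast hn i hi hik)
    _ = 1 := by simp [hk0.ne']
end

section
/- Let G be a finite simple graph with m edges. Let P_1, …, P_t be paths in G, and let ℓ_i denote the number of edges of P_i. Let Q be a finite family of pairwise edge-disjoint paths in G, and suppose there is a map b : Q → {1,…,t} such that every Q ∈ Q shares at least one edge with P_{b(Q)} and has at least ℓ_{b(Q)} edges. Then |Q|² ≤ t·m; equivalently, |Q| ≤ √(t·m). -/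
open SimpleGraph

/-- Pairwise edge-disjoint trails have total length at most the number of edges. -/
theorem sum_length_le_card_edgeFinset {V : Type*} [DecidableEq V] {G : SimpleGraph V}
    [Fintype G.edgeSet] {K : Type*} [Fintype K] {x y : K → V}
    (Q : (q : K) → G.Walk (x q) (y q)) (hQ : ∀ q, (Q q).IsTrail)
    (hdisj : ∀ q q', q ≠ q' → ∀ e, e ∈ (Q q).edges → e ∉ (Q q').edges) :
    ∑ q, (Q q).length ≤ G.edgeFinset.card := by
  have hcard (q : K) : (Q q).edges.toFinset.card = (Q q).length := by
    rw [List.toFinset_card_of_nodup (hQ q).edges_nodup, Walk.length_edges]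
  simp_rw [← hcard]
  rw [← Finset.card_biUnion]
  · refine Finset.card_le_card fun e he ↦ ?_
    simp only [Finset.mem_biUnion, Finset.mem_univ, true_and, List.mem_toFinset] at he
    obtain ⟨q, hq⟩ := he
    exact mem_edgeFinset.2 ((Q q).edges_subset_edgeSet hq)
  · intro q _ q' _ hne
    refine Finset.disjoint_left.2 fun e he he' ↦ ?_
    exact hdisj q q' hne e (List.mem_toFinset.1 he) (List.mem_toFinset.1 he')

/-- A walk meets at most as many pairwise edge-disjoint walks as it has edges. -/
theorem card_le_length_of_edges_inter {V : Type*} [DecidableEq V] {G : SimpleGraph V}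
    {u v : V} (p : G.Walk u v) {K : Type*} {x y : K → V}
    (Q : (q : K) → G.Walk (x q) (y q)) (s : Finset K)
    (hdisj : ∀ q q', q ≠ q' → ∀ e, e ∈ (Q q).edges → e ∉ (Q q').edges)
    (hmeet : ∀ q ∈ s, ∃ e, e ∈ (Q q).edges ∧ e ∈ p.edges) :
    s.card ≤ p.length := by
  calc s.card ≤ p.edges.toFinset.card := by
        refine Finset.card_le_card_of_forall_subsingleton (fun q e ↦ e ∈ (Q q).edges) ?_ ?_
        · intro q hq
          obtain ⟨e, heQ, hep⟩ := hmeet q hq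
          exact ⟨e, List.mem_toFinset.2 hep, heQ⟩
        · intro e _ q hq q' hq'
          by_contra hne
          exact hdisj q q' hne e hq.2 hq'.2
    _ ≤ p.length := p.length_edges ▸ p.edges.toFinset_card_le

/-- Let `G` be a finite simple graph with `m` edges, `P_1, …, P_t` paths
in `G` with `ℓ_i` edges each, and `Q` a finite family of pairwise edge-disjoint paths such
that every `Q ∈ 𝒬` shares an edge with `P_{b(Q)}` and has at least `ℓ_{b(Q)}` edges. Then
`|𝒬|² ≤ t·m`; equivalently, `|𝒬| ≤ √(t·m)`. -/
theorem greedy_blocking_bound (V : Type) [Fintype V] [DecidableEq V]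
    (G : SimpleGraph V) [DecidableRel G.Adj] (m : ℕ) (hm : G.edgeFinset.card = m)
    (t : ℕ) (u v : Fin t → V) (P : (i : Fin t) → G.Walk (u i) (v i))
    (hP : ∀ i, (P i).IsPath)
    (K : Type) [Fintype K] (x y : K → V) (Q : (q : K) → G.Walk (x q) (y q))
    (hQ : ∀ q, (Q q).IsPath)
    (hdisj : ∀ q q', q ≠ q' → ∀ e, e ∈ (Q q).edges → e ∉ (Q q').edges)
    (b : K → Fin t)
    (hblock : ∀ q, ∃ e, e ∈ (Q q).edges ∧ e ∈ (P (b q)).edges)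
    (hlen : ∀ q, (P (b q)).length ≤ (Q q).length) :
    Fintype.card K ^ 2 ≤ t * m ∧ (Fintype.card K : ℝ) ≤ Real.sqrt (t * m) := by
  classical
  have hsq : Fintype.card K ^ 2 ≤ t * m := by
    set k : Fin t → ℕ := fun i ↦ (Finset.univ.filter (b · = i)).card with hk
    have hcard : Fintype.card K = ∑ i, k i :=
      Finset.card_eq_sum_card_fiberwise (s := Finset.univ) fun q _ ↦ Finset.mem_univ (b q)
    have hle (i : Fin t) : k i ≤ (P i).length := by
      refine card_le_length_of_edges_inter (P i) Q _ hdisj fun q hq ↦ ?_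
      obtain rfl := (Finset.mem_filter.1 hq).2
      exact hblock q
    have hsum : ∑ i, k i ^ 2 ≤ m :=
      calc ∑ i, k i ^ 2 ≤ ∑ i, k i * (P i).length :=
            Finset.sum_le_sum fun i _ ↦ sq (k i) ▸ Nat.mul_le_mul_left _ (hle i)
        _ = ∑ q, (P (b q)).length := by
            simpa [hk] using Finset.sum_fiberwise' Finset.univ b fun i ↦ (P i).length
        _ ≤ ∑ q, (Q q).length := Finset.sum_le_sum fun q _ ↦ hlen q
        _ ≤ m := hm ▸ sum_length_le_card_edgeFinset Q (fun q ↦ (hQ q).isTrail) hdisj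
    calc Fintype.card K ^ 2 = (∑ i, k i) ^ 2 := by rw [hcard]
      _ ≤ t * ∑ i, k i ^ 2 := by
          simpa using sq_sum_le_card_mul_sum_sq (s := Finset.univ) (f := k)
      _ ≤ t * m := Nat.mul_le_mul_left t hsum
  exact ⟨hsq, Real.le_sqrt_of_sq_le (by exact_mod_cast hsq)⟩
end
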